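/- arXiv:2011.06834 — 2 statements merged into one kernel-verified Lean document; each statement's English description precedes it below -/
import Mathlib

section
/- Let 1 < q < ∞ and q* = q/(q−1). Then for all x ∈ [0, π_{q*,q}/4) (equivalently x ∈ [0, π_{2,q}/2^{2/q+1})), sin_{2,q}(2^{2/q} x) = 2^{2/q} · sin_{q*,q}(x) · (cos_{q*,q}(x))^{q*−1}. -/
open MeasureTheory Set
open scoped ENNReal

/-- `genF p q y = ∫_0^y (1 - t^q)^(-1/p) dt`, whose inverse is the generalized sine. -/
noncomputable def genF (p q y : ℝ) : ℝ := ∫ t in (0:ℝ)..y, (1 - t ^ q) ^ (-(1 / p))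

/-- `genG p q y = ∫_0^y (1 + t^q)^(-1/p) dt`, whose inverse is the generalized hyperbolic sine. -/
noncomputable def genG (p q y : ℝ) : ℝ := ∫ t in (0:ℝ)..y, (1 + t ^ q) ^ (-(1 / p))

/-- The generalized π, `π_{p,q} = 2∫_0^1 (1 - t^q)^(-1/p) dt`, as an extended real number
(it is `∞` when `q/(q+1) < p ≤ 1`). -/
noncomputable def genPi (p q : ℝ) : ℝ≥0∞ :=
  2 * ∫⁻ t in Ioo (0:ℝ) 1, ENNReal.ofReal ((1 - t ^ q) ^ (-(1 / p)))

/-- The generalized sine `sin_{p,q}`: the inverse of `genF p q`, which maps `[0,1)` onto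
`[0, π_{p,q}/2)`. -/
noncomputable def gsin (p q : ℝ) : ℝ → ℝ := Function.invFunOn (genF p q) (Ico 0 1)

/-- The generalized cosine `cos_{p,q} x = (d/dx) sin_{p,q} x` (one-sided at `x = 0`). -/
noncomputable def gcos (p q x : ℝ) : ℝ := derivWithin (gsin p q) (Ici 0) x

/-- The generalized hyperbolic sine `sinh_{p,q}`: the inverse of `genG p q`, which maps
`[0,∞)` onto `[0, π_{r,q}/2)` where `r = pq/(pq+p-q)`. -/
noncomputable def gsinh (p q : ℝ) : ℝ → ℝ := Function.invFunOn (genG p q) (Ici 0)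

/-- The generalized hyperbolic cosine `cosh_{p,q} x = (d/dx) sinh_{p,q} x`
(one-sided at `x = 0`). -/
noncomputable def gcosh (p q x : ℝ) : ℝ := derivWithin (gsinh p q) (Ici 0) x

open Filter Topology

lemma one_sub_rpow_pos {q t : ℝ} (hq : 0 < q) (ht : t ∈ Ioo (-1 : ℝ) 1) : 0 < 1 - t ^ q := by
  have h1 : |t| ^ q < 1 := Real.rpow_lt_one (abs_nonneg t) (abs_lt.2 ⟨ht.1, ht.2⟩) hq
  linarith [le_abs_self (t ^ q), Real.abs_rpow_le_abs_rpow t q]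

lemma continuousOn_genF_integrand (p : ℝ) {q : ℝ} (hq : 0 < q) :
    ContinuousOn (fun t : ℝ => (1 - t ^ q) ^ (-(1 / p))) (Ioo (-1) 1) := by
  refine ContinuousOn.rpow_const ?_ fun t ht => Or.inl (one_sub_rpow_pos hq ht).ne'
  exact (continuous_const.sub (Real.continuous_rpow_const hq.le)).continuousOn

lemma genF_hasStrictDerivAt (p : ℝ) {q y : ℝ} (hq : 0 < q) (hy : y ∈ Ioo (-1 : ℝ) 1) :
    HasStrictDerivAt (genF p q) ((1 - y ^ q) ^ (-(1 / p))) y := by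
  have hc := continuousOn_genF_integrand p hq
  refine intervalIntegral.integral_hasStrictDerivAt_right
    (hc.mono ?_).intervalIntegrable (hc.stronglyMeasurableAtFilter isOpen_Ioo y hy)
    (hc.continuousAt (isOpen_Ioo.mem_nhds hy))
  exact ordConnected_Ioo.uIcc_subset (by norm_num) hy

lemma genF_strictMonoOn (p : ℝ) {q : ℝ} (hq : 0 < q) :
    StrictMonoOn (genF p q) (Ioo (-1) 1) := by
  refine strictMonoOn_of_deriv_pos (convex_Ioo _ _) (fun y hy =>
    (genF_hasStrictDerivAt p hq hy).hasDerivAt.continuousAt.continuousWithinAt) fun y hy => ?_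
  rw [interior_Ioo] at hy
  rw [(genF_hasStrictDerivAt p hq hy).hasDerivAt.deriv]
  exact Real.rpow_pos_of_pos (one_sub_rpow_pos hq hy) _

lemma genF_zero (p q : ℝ) : genF p q 0 = 0 := by simp [genF]

lemma Ico_zero_one_subset_Ioo : Ico (0 : ℝ) 1 ⊆ Ioo (-1) 1 :=
  fun _ h => ⟨by linarith [h.1], h.2⟩

lemma gsin_genF (p : ℝ) {q y : ℝ} (hq : 0 < q) (hy : y ∈ Ico (0 : ℝ) 1) :
    gsin p q (genF p q y) = y :=
  ((genF_strictMonoOn p hq).injOn.mono Ico_zero_one_subset_Ioo).leftInvOn_invFunOn hy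

lemma gcos_genF (p : ℝ) {q y : ℝ} (hq : 0 < q) (hy : y ∈ Ico (0 : ℝ) 1) :
    gcos p q (genF p q y) = (1 - y ^ q) ^ (1 / p) := by
  have hy' := Ico_zero_one_subset_Ioo hy
  have hpos := one_sub_rpow_pos hq hy'
  have hd := genF_hasStrictDerivAt p hq hy'
  have hne : (1 - y ^ q) ^ (-(1 / p)) ≠ 0 := (Real.rpow_pos_of_pos hpos _).ne'
  have hmono := genF_strictMonoOn p hq
  have hnhds : ∀ᶠ t in 𝓝 y, t ∈ Ioo (-1 : ℝ) 1 := isOpen_Ioo.mem_nhds hy'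
  have hleft : LeftInvOn (Function.invFunOn (genF p q) (Ioo (-1) 1)) (genF p q) (Ioo (-1) 1) :=
    hmono.injOn.leftInvOn_invFunOn
  have hinv := (hd.to_local_left_inverse hne
    (hnhds.mono fun t ht => hleft ht)).hasDerivAt.hasDerivWithinAt (s := Ici 0)
  have hnonneg : 0 ≤ genF p q y := by
    rw [← genF_zero p q]
    exact hmono.monotoneOn (by norm_num) hy' hy.1
  have heq : gsin p q =ᶠ[𝓝[Ici 0] (genF p q y)]
      Function.invFunOn (genF p q) (Ioo (-1) 1) := by
    refine eventually_nhdsWithin_iff.2 ?_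
    rw [← hd.map_nhds_eq hne, eventually_map]
    filter_upwards [hnhds] with t ht ht0
    have h0 : 0 ≤ t := by
      rw [mem_Ici, ← genF_zero p q] at ht0
      exact (hmono.le_iff_le (by norm_num) ht).1 ht0
    rw [gsin_genF p hq ⟨h0, ht.2⟩, hleft ht]
  rw [gcos, (hinv.congr_of_eventuallyEq_of_mem heq hnonneg).derivWithin
    (uniqueDiffOn_Ici 0 _ hnonneg), Real.rpow_neg hpos.le, inv_inv]

lemma hasDerivAt_one_sub_rpow_rpow {q t : ℝ} (hq : 1 < q) (ht : t ∈ Ioo (-1 : ℝ) 1) :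
    HasDerivAt (fun t : ℝ => (1 - t ^ q) ^ (1 / q))
      (-(t ^ (q - 1) * (1 - t ^ q) ^ (1 / q - 1))) t := by
  have h := ((Real.hasDerivAt_rpow_const (x := t) (p := q) (Or.inr hq.le)).const_sub 1).rpow_const
    (p := 1 / q) (Or.inl (one_sub_rpow_pos (by linarith) ht).ne')
  convert h using 1
  field_simp

lemma exponent_conjugate {q qs : ℝ} (hq : 1 < q) (hqs : qs = q / (q - 1)) :
    -(1 / qs) = 1 / q - 1 := by
  subst hqs
  have : q - 1 ≠ 0 := by linarith
  field_simp
  ring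

lemma four_mul_rpow_lt_one {u : ℝ} (h : u < 1 / 2) : 4 * (u * (1 - u)) < 1 := by
  nlinarith [sq_pos_of_pos (show 0 < 1 - 2 * u by linarith)]

lemma doubling_rpow {q t : ℝ} (hq : 1 < q) (ht : t ∈ Ico (0 : ℝ) 1) :
    ((2 : ℝ) ^ (2 / q) * (t * (1 - t ^ q) ^ (1 / q))) ^ q = 4 * (t ^ q * (1 - t ^ q)) := by
  have hpos := one_sub_rpow_pos (by linarith : 0 < q) (Ico_zero_one_subset_Ioo ht)
  have hq0 : q ≠ 0 := by linarith
  rw [Real.mul_rpow (by positivity) (mul_nonneg ht.1 (by positivity)),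
    Real.mul_rpow ht.1 (by positivity), ← Real.rpow_mul (by norm_num), ← Real.rpow_mul hpos.le,
    div_mul_cancel₀ _ hq0, one_div_mul_cancel hq0, Real.rpow_one]
  norm_num

lemma doubling_mem_Ico {q t : ℝ} (hq : 1 < q) (ht : t ∈ Ico (0 : ℝ) 1) (h : t ^ q < 1 / 2) :
    (2 : ℝ) ^ (2 / q) * (t * (1 - t ^ q) ^ (1 / q)) ∈ Ico (0 : ℝ) 1 := by
  have hpos := one_sub_rpow_pos (by linarith : 0 < q) (Ico_zero_one_subset_Ioo ht)
  refine ⟨mul_nonneg (by positivity) (mul_nonneg ht.1 (by positivity)), ?_⟩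
  by_contra! hge
  have h1 := Real.one_le_rpow hge (by linarith : 0 ≤ q)
  rw [doubling_rpow hq ht] at h1
  linarith [four_mul_rpow_lt_one h]

lemma genF_two_doubling {q qs y : ℝ} (hq : 1 < q) (hqs : qs = q / (q - 1))
    (hy : y ∈ Ico (0 : ℝ) 1) (h : y ^ q < 1 / 2) :
    genF 2 q ((2 : ℝ) ^ (2 / q) * (y * (1 - y ^ q) ^ (1 / q))) =
      (2 : ℝ) ^ (2 / q) * genF qs q y := by
  have hq0 : 0 < q := by linarith
  have key : ∀ t ∈ Icc 0 y, HasDerivAt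
      (fun t => genF 2 q ((2 : ℝ) ^ (2 / q) * (t * (1 - t ^ q) ^ (1 / q))) -
        (2 : ℝ) ^ (2 / q) * genF qs q t) 0 t := by
    intro t ht
    have ht1 : t ∈ Ico (0 : ℝ) 1 := ⟨ht.1, ht.2.trans_lt hy.2⟩
    have ht' := Ico_zero_one_subset_Ioo ht1
    have hu : t ^ q < 1 / 2 := (Real.rpow_le_rpow ht.1 ht.2 hq0.le).trans_lt h
    have hpos := one_sub_rpow_pos hq0 ht'
    have h1 := (genF_hasStrictDerivAt 2 hq0
      (Ico_zero_one_subset_Ioo (doubling_mem_Ico hq ht1 hu))).hasDerivAt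
    have h2 := ((hasDerivAt_id t).mul (hasDerivAt_one_sub_rpow_rpow hq ht')).const_mul
      ((2 : ℝ) ^ (2 / q))
    have h3 := (genF_hasStrictDerivAt qs hq0 ht').hasDerivAt.const_mul ((2 : ℝ) ^ (2 / q))
    have h4 := (h1.comp t h2).sub h3
    refine h4.congr_deriv ?_
    have e1 : (1 - ((2 : ℝ) ^ (2 / q) * (t * (1 - t ^ q) ^ (1 / q))) ^ q) ^ (-(1 / 2 : ℝ)) =
        (1 - 2 * t ^ q)⁻¹ := by
      rw [doubling_rpow hq ht1,
        show 1 - 4 * (t ^ q * (1 - t ^ q)) = (1 - 2 * t ^ q) ^ (2 : ℝ) by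
          rw [Real.rpow_two]; ring,
        ← Real.rpow_mul (by linarith)]
      norm_num [Real.rpow_neg_one]
    have e2 : (1 - t ^ q) ^ (1 / q) = (1 - t ^ q) ^ (1 / q - 1) * (1 - t ^ q) := by
      rw [← Real.rpow_add_one hpos.ne']; simp
    have e3 : t * t ^ (q - 1) = t ^ q := by
      rcases ht.1.eq_or_lt with h0 | h0
      · simp [← h0, hq0.ne']
      · rw [mul_comm, ← Real.rpow_add_one h0.ne']; simp
    rw [e1, exponent_conjugate hq hqs]
    have hinv : (1 - 2 * t ^ q)⁻¹ * (1 - 2 * t ^ q) = 1 := inv_mul_cancel₀ (by linarith)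
    simp only [id, e2]
    linear_combination ((2 : ℝ) ^ (2 / q) * (1 - t ^ q) ^ (1 / q - 1)) * hinv -
      ((1 - 2 * t ^ q)⁻¹ * (2 : ℝ) ^ (2 / q) * (1 - t ^ q) ^ (1 / q - 1)) * e3
  have := constant_of_has_deriv_right_zero
    (fun t ht => (key t ht).continuousAt.continuousWithinAt)
    (fun t ht => (key t (Ico_subset_Icc_self ht)).hasDerivWithinAt) y ⟨hy.1, le_rfl⟩
  simp only [zero_mul, mul_zero, genF_zero, sub_zero] at this
  linarith

lemma half_rpow_mem_Ioo {q : ℝ} (hq : 0 < q) : (1 / 2 : ℝ) ^ (1 / q) ∈ Ioo (0 : ℝ) 1 :=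
  ⟨by positivity, Real.rpow_lt_one (by norm_num) (by norm_num) (by positivity)⟩

lemma half_rpow_rpow {q : ℝ} (hq : 0 < q) : ((1 / 2 : ℝ) ^ (1 / q)) ^ q = 1 / 2 := by
  rw [← Real.rpow_mul (by norm_num), one_div_mul_cancel hq.ne', Real.rpow_one]

lemma genF_le_two_mul_genF_half {q qs y : ℝ} (hq : 1 < q) (hqs : qs = q / (q - 1))
    (hy : y ∈ Ico ((1 / 2 : ℝ) ^ (1 / q)) 1) :
    genF qs q y ≤ 2 * genF qs q ((1 / 2 : ℝ) ^ (1 / q)) := by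
  have hq0 : 0 < q := by linarith
  have hb := half_rpow_mem_Ioo hq0
  have hmem : ∀ t ∈ Icc ((1 / 2 : ℝ) ^ (1 / q)) y, (1 - t ^ q) ^ (1 / q) ∈ Ico (0 : ℝ) 1 := by
    intro t ht
    have ht0 : 0 < t := hb.1.trans_le ht.1
    have hpos := one_sub_rpow_pos hq0 (⟨by linarith, ht.2.trans_lt hy.2⟩ : t ∈ Ioo (-1 : ℝ) 1)
    exact ⟨by positivity, Real.rpow_lt_one hpos.le (by linarith [Real.rpow_pos_of_pos ht0 q])
      (by positivity)⟩
  have key : ∀ t ∈ Icc ((1 / 2 : ℝ) ^ (1 / q)) y, HasDerivAt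
      (fun t => genF qs q t + genF qs q ((1 - t ^ q) ^ (1 / q))) 0 t := by
    intro t ht
    have ht0 : 0 < t := hb.1.trans_le ht.1
    have ht' : t ∈ Ioo (-1 : ℝ) 1 := ⟨by linarith, ht.2.trans_lt hy.2⟩
    have hpos := one_sub_rpow_pos hq0 ht'
    have h1 := (genF_hasStrictDerivAt qs hq0 (Ico_zero_one_subset_Ioo (hmem t ht))).hasDerivAt
    have h2 := (genF_hasStrictDerivAt qs hq0 ht').hasDerivAt
    refine (h2.add (h1.comp t (hasDerivAt_one_sub_rpow_rpow hq ht'))).congr_deriv ?_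
    have e : (t ^ q) ^ (1 / q - 1) * t ^ (q - 1) = 1 := by
      rw [← Real.rpow_mul ht0.le, ← Real.rpow_add ht0,
        show q * (1 / q - 1) + (q - 1) = 0 by field_simp; ring, Real.rpow_zero]
    rw [exponent_conjugate hq hqs, ← Real.rpow_mul hpos.le, one_div_mul_cancel hq0.ne',
      Real.rpow_one, sub_sub_cancel]
    linear_combination (-(1 - t ^ q) ^ (1 / q - 1)) * e
  have h := constant_of_has_deriv_right_zero
    (fun t ht => (key t ht).continuousAt.continuousWithinAt)
    (fun t ht => (key t (Ico_subset_Icc_self ht)).hasDerivWithinAt) y ⟨hy.1, le_rfl⟩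
  rw [half_rpow_rpow hq0, show (1 - 1 / 2 : ℝ) = 1 / 2 by norm_num] at h
  have hz := hmem y ⟨hy.1, le_rfl⟩
  have hnn : 0 ≤ genF qs q ((1 - y ^ q) ^ (1 / q)) := by
    rw [← genF_zero qs q]
    exact (genF_strictMonoOn qs hq0).monotoneOn (by norm_num) (Ico_zero_one_subset_Ioo hz) hz.1
  linarith

lemma integrableOn_genF_integrand {p q : ℝ} (hp : 1 < p) (hq : 1 ≤ q) :
    IntegrableOn (fun t : ℝ => (1 - t ^ q) ^ (-(1 / p))) (Icc 0 1) := by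
  have hp' : 1 / p < 1 := (div_lt_one (by linarith)).2 hp
  have hi : IntervalIntegrable (fun t : ℝ => (1 - t) ^ (-(1 / p))) volume 0 1 := by
    simpa using ((intervalIntegral.intervalIntegrable_rpow' (a := 0) (b := 1)
      (r := -(1 / p)) (by linarith)).comp_sub_left 1).symm
  rw [integrableOn_Icc_iff_integrableOn_Ioo]
  rw [intervalIntegrable_iff_integrableOn_Ioo_of_le zero_le_one] at hi
  refine hi.mono' (((continuousOn_genF_integrand p (by linarith)).mono
    (Ioo_subset_Ioo_left (by norm_num))).aestronglyMeasurable measurableSet_Ioo) ?_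
  refine (ae_restrict_iff' measurableSet_Ioo).2 (ae_of_all _ fun t ht => ?_)
  have h1 : t ^ q ≤ t := Real.rpow_le_self_of_le_one ht.1.le ht.2.le hq
  have h2 : 0 < 1 - t := by linarith [ht.2]
  rw [Real.norm_of_nonneg (Real.rpow_nonneg (by linarith) _)]
  exact Real.rpow_le_rpow_of_nonpos h2 (by linarith)
    (by simpa using (by linarith : (0 : ℝ) ≤ p))

lemma genPi_eq {p q : ℝ} (hp : 1 < p) (hq : 1 ≤ q) :
    genPi p q = ENNReal.ofReal (2 * genF p q 1) := by
  have hi := (integrableOn_genF_integrand hp hq).mono_set Ioo_subset_Icc_self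
  rw [genPi, ← ofReal_integral_eq_lintegral_ofReal hi, genF,
    intervalIntegral.integral_of_le zero_le_one, integral_Ioc_eq_integral_Ioo,
    ENNReal.ofReal_mul zero_le_two, ENNReal.ofReal_ofNat]
  refine (ae_restrict_iff' measurableSet_Ioo).2 (ae_of_all _ fun t ht => ?_)
  exact Real.rpow_nonneg (one_sub_rpow_pos (by linarith) ⟨by linarith [ht.1], ht.2⟩).le _

lemma genF_one_le_two_mul_genF_half {q qs : ℝ} (hq : 1 < q) (hqs : qs = q / (q - 1)) :
    genF qs q 1 ≤ 2 * genF qs q ((1 / 2 : ℝ) ^ (1 / q)) := by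
  have hq' : 1 < qs := by
    rw [hqs, one_lt_div (by linarith)]
    linarith
  have hc : ContinuousOn (genF qs q) (uIcc 0 1) :=
    intervalIntegral.continuousOn_primitive_interval
      (by simpa using integrableOn_genF_integrand hq' hq.le)
  rw [uIcc_of_le zero_le_one] at hc
  have hb := half_rpow_mem_Ioo (by linarith : 0 < q)
  have hlim : Tendsto (genF qs q) (𝓝[<] 1) (𝓝 (genF qs q 1)) := by
    refine (hc 1 (by norm_num)).mono_left ?_
    rw [← nhdsWithin_Ioo_eq_nhdsLT (zero_lt_one' ℝ)]
    exact nhdsWithin_mono _ Ioo_subset_Icc_self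
  refine le_of_tendsto hlim ?_
  filter_upwards [Ico_mem_nhdsLT hb.2] with y hy using genF_le_two_mul_genF_half hq hqs hy

/-- for `1 < q < ∞`, `q* = q/(q-1)` and `x ∈ [0, π_{q*,q}/4)`,
`sin_{2,q}(2^(2/q) x) = 2^(2/q) · sin_{q*,q} x · (cos_{q*,q} x)^(q*-1)`. -/
theorem multiple_angle_sin (q qs : ℝ) (hq : 1 < q) (hqs : qs = q / (q - 1))
    (x : ℝ) (hx0 : 0 ≤ x) (hx : ENNReal.ofReal x < genPi qs q / 4) :
    gsin 2 q ((2:ℝ) ^ (2 / q) * x) =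
      (2:ℝ) ^ (2 / q) * gsin qs q x * gcos qs q x ^ (qs - 1) := by
  have hq0 : 0 < q := by linarith
  have hqs1 : 1 < qs := by
    rw [hqs, one_lt_div (by linarith)]
    linarith
  have hb := half_rpow_mem_Ioo hq0
  have hxb : x < genF qs q ((1 / 2 : ℝ) ^ (1 / q)) := by
    rw [genPi_eq hqs1 hq.le, ← ENNReal.ofReal_ofNat 4, ← ENNReal.ofReal_div_of_pos (by norm_num),
      ENNReal.ofReal_lt_ofReal_iff_of_nonneg hx0] at hx
    linarith [genF_one_le_two_mul_genF_half hq hqs]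
  obtain ⟨y, hy, rfl⟩ : x ∈ genF qs q '' Icc 0 ((1 / 2 : ℝ) ^ (1 / q)) := by
    refine intermediate_value_Icc hb.1.le (fun t ht => ?_) ⟨by rwa [genF_zero], hxb.le⟩
    exact (genF_hasStrictDerivAt qs hq0 (Ico_zero_one_subset_Ioo
      ⟨ht.1, ht.2.trans_lt hb.2⟩)).hasDerivAt.continuousAt.continuousWithinAt
  have hylt : y < (1 / 2 : ℝ) ^ (1 / q) := hy.2.lt_of_ne (by rintro rfl; exact hxb.false)
  have hy1 : y ∈ Ico (0 : ℝ) 1 := ⟨hy.1, hylt.trans hb.2⟩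
  have hyq : y ^ q < 1 / 2 := by
    rw [← half_rpow_rpow hq0]
    exact Real.rpow_lt_rpow hy.1 hylt hq0
  have hpos := one_sub_rpow_pos hq0 (Ico_zero_one_subset_Ioo hy1)
  have hexp : 1 / qs * (qs - 1) = 1 / q := by
    subst hqs
    have : q - 1 ≠ 0 := by linarith
    field_simp
    ring
  rw [← genF_two_doubling hq hqs hy1 hyq, gsin_genF 2 hq0 (doubling_mem_Ico hq hy1 hyq),
    gsin_genF qs hq0 hy1, gcos_genF qs hq0 hy1, ← Real.rpow_mul hpos.le, hexp, mul_assoc]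
end

section
/- Let 1 < q < ∞. Then for all x ∈ [0, π_{q*,q}/4), sinh_{2q/(q+2),q}(2^{2/q} x) = 2^{2/q} · sinh_{q/2,q}(x) / (1 − (sinh_{q/2,q}(x))^q)^{2/q}. -/
open MeasureTheory Set
open scoped ENNReal

section

variable {q y z : ℝ}

theorem one_add_rpow_pos (q : ℝ) (hy : 0 ≤ y) : 0 < 1 + y ^ q :=
  add_pos_of_pos_of_nonneg one_pos (Real.rpow_nonneg hy q)

theorem continuousOn_one_add_rpow_rpow (hq : 0 ≤ q) (r : ℝ) :
    ContinuousOn (fun t : ℝ => (1 + t ^ q) ^ r) (Ici 0) := by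
  refine ContinuousOn.rpow_const ?_ fun t ht => Or.inl (one_add_rpow_pos q ht).ne'
  exact (continuous_const.add (Real.continuous_rpow_const hq)).continuousOn

theorem intervalIntegrable_one_add_rpow_rpow (hq : 0 ≤ q) (r : ℝ) (hy : 0 ≤ y) (hz : 0 ≤ z) :
    IntervalIntegrable (fun t : ℝ => (1 + t ^ q) ^ r) volume y z :=
  ((continuousOn_one_add_rpow_rpow hq r).mono fun _ ht =>
    (le_min hy hz).trans ht.1).intervalIntegrable

theorem genG_strictMonoOn (p : ℝ) (hq : 0 ≤ q) : StrictMonoOn (genG p q) (Ici 0) := by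
  intro a ha b hb hab
  have hsub := intervalIntegral.integral_interval_sub_left
    (intervalIntegrable_one_add_rpow_rpow hq (-(1 / p)) le_rfl hb)
    (intervalIntegrable_one_add_rpow_rpow hq (-(1 / p)) le_rfl ha)
  have hpos := intervalIntegral.intervalIntegral_pos_of_pos_on
    (intervalIntegrable_one_add_rpow_rpow hq (-(1 / p)) ha hb)
    (fun t ht => Real.rpow_pos_of_pos (one_add_rpow_pos q ((mem_Ici.1 ha).trans ht.1.le)) _) hab
  unfold genG
  linarith

theorem genG_continuousOn (p : ℝ) (hq : 0 ≤ q) (hy : 0 ≤ y) :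
    ContinuousOn (genG p q) (Icc 0 y) := by
  rw [← uIcc_of_le hy]
  refine intervalIntegral.continuousOn_primitive_interval ?_
  rw [uIcc_of_le hy]
  exact ((continuousOn_one_add_rpow_rpow hq _).mono Icc_subset_Ici_self).integrableOn_Icc

theorem gsinh_genG (p : ℝ) (hq : 0 ≤ q) (hy : 0 ≤ y) : gsinh p q (genG p q y) = y :=
  (genG_strictMonoOn p hq).injOn.leftInvOn_invFunOn hy

theorem hasDerivAt_double_angle (hq : 1 < q) (hy0 : 0 ≤ y) (hy1 : y < 1) :
    HasDerivAt (fun t : ℝ => (2:ℝ) ^ (2 / q) * t * (1 - t ^ q) ^ (-(2 / q)))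
      ((2:ℝ) ^ (2 / q) * (1 + y ^ q) * (1 - y ^ q) ^ (-(2 / q) - 1)) y := by
  have hpos : 0 < 1 - y ^ q := sub_pos.2 (Real.rpow_lt_one hy0 hy1 (by linarith))
  have h1 := (Real.hasDerivAt_rpow_const (x := y) (p := q) (Or.inr hq.le)).const_sub 1
  have h2 := h1.rpow_const (p := -(2 / q)) (Or.inl hpos.ne')
  have h3 := ((hasDerivAt_id y).const_mul ((2:ℝ) ^ (2 / q))).mul h2
  refine h3.congr_deriv ?_
  have e1 : (1 - y ^ q) ^ (-(2 / q)) = (1 - y ^ q) ^ (-(2 / q) - 1) * (1 - y ^ q) := by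
    rw [← Real.rpow_add_one hpos.ne']; ring_nf
  have e2 : y * y ^ (q - 1) = y ^ q := by
    rw [mul_comm, ← Real.rpow_add_one' hy0 (by linarith)]; ring_nf
  have e3 : q * (2 / q) = 2 := by field_simp
  simp only [id, e1]
  linear_combination ((2:ℝ) ^ (2 / q) * (1 - y ^ q) ^ (-(2 / q) - 1)) *
    (q * (2 / q) * e2 + y ^ q * e3)

theorem double_angle_rpow (hq : 1 < q) (hy0 : 0 ≤ y) (hy1 : y < 1) :
    1 + ((2:ℝ) ^ (2 / q) * y * (1 - y ^ q) ^ (-(2 / q))) ^ q =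
      ((1 + y ^ q) / (1 - y ^ q)) ^ (2:ℝ) := by
  have hpos : 0 < 1 - y ^ q := sub_pos.2 (Real.rpow_lt_one hy0 hy1 (by linarith))
  have hq0 : q ≠ 0 := by linarith
  rw [Real.mul_rpow (by positivity) (by positivity), Real.mul_rpow (by positivity) hy0,
    ← Real.rpow_mul (by norm_num), ← Real.rpow_mul hpos.le, neg_mul, div_mul_cancel₀ _ hq0,
    Real.rpow_neg hpos.le, Real.rpow_two, Real.rpow_two, Real.rpow_two]
  field_simp
  ring

theorem genG_double_angle (hq : 1 < q) (hy0 : 0 ≤ y) (hy1 : y < 1) :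
    genG (2 * q / (q + 2)) q ((2:ℝ) ^ (2 / q) * y * (1 - y ^ q) ^ (-(2 / q))) =
      (2:ℝ) ^ (2 / q) * genG (q / 2) q y := by
  have hq0 : (0:ℝ) < q := by linarith
  have hlt : ∀ t ∈ uIcc 0 y, 0 ≤ t ∧ t < 1 := fun t ht => by
    rw [uIcc_of_le hy0] at ht; exact ⟨ht.1, ht.2.trans_lt hy1⟩
  have hpos : ∀ t ∈ uIcc 0 y, 0 < 1 - t ^ q := fun t ht =>
    sub_pos.2 (Real.rpow_lt_one (hlt t ht).1 (hlt t ht).2 hq0)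
  have hcont : Continuous fun t : ℝ => t ^ q := Real.continuous_rpow_const hq0.le
  have key := intervalIntegral.integral_comp_mul_deriv' (a := 0) (b := y)
    (g := fun t : ℝ => (1 + t ^ q) ^ (-(1 / (2 * q / (q + 2)))))
    (fun t ht => hasDerivAt_double_angle hq (hlt t ht).1 (hlt t ht).2)
    (((continuous_const.mul (continuous_const.add hcont)).continuousOn).mul
      ((continuous_const.sub hcont).continuousOn.rpow_const fun t ht => Or.inl (hpos t ht).ne'))
    ((continuousOn_one_add_rpow_rpow hq0.le _).mono (by
      rintro _ ⟨t, ht, rfl⟩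
      have := hpos t ht
      have := (hlt t ht).1
      simp only [mem_Ici]
      positivity))
  simp only [mul_zero, zero_mul] at key
  unfold genG
  rw [← key, ← intervalIntegral.integral_const_mul]
  refine intervalIntegral.integral_congr fun t ht => ?_
  have h1 := hpos t ht
  have h2 := one_add_rpow_pos q (hlt t ht).1
  simp only [Function.comp]
  have e : (2:ℝ) * -(1 / (2 * q / (q + 2))) = -(2 / q) - 1 := by field_simp; ring
  rw [double_angle_rpow hq (hlt t ht).1 (hlt t ht).2, ← Real.rpow_mul (by positivity), e,
    Real.div_rpow h2.le h1.le]
  have e' : -(1 / (q / 2)) = -(2 / q) := by field_simp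
  rw [e', show (1 + t ^ q) ^ (-(2 / q)) = (1 + t ^ q) ^ (-(2 / q) - 1) * (1 + t ^ q) by
    rw [← Real.rpow_add_one h2.ne']; ring_nf]
  have := Real.rpow_pos_of_pos h1 (-(2 / q) - 1)
  field_simp

theorem hasDerivAt_one_add_rpow_inv (hq : 1 < q) (hy : 0 ≤ y) :
    HasDerivAt (fun t : ℝ => (1 + t ^ q) ^ (-(1 / q)))
      (-(y ^ (q - 1) * (1 + y ^ q) ^ (-(1 / q) - 1))) y := by
  have h1 := (Real.hasDerivAt_rpow_const (x := y) (p := q) (Or.inr hq.le)).const_add 1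
  have h2 := h1.rpow_const (p := -(1 / q)) (Or.inl (one_add_rpow_pos q hy).ne')
  refine h2.congr_deriv ?_
  have e3 : q * (1 / q) = 1 := by field_simp
  linear_combination (-(y ^ (q - 1)) * (1 + y ^ q) ^ (-(1 / q) - 1)) * e3

theorem hasDerivAt_mul_one_add_rpow_inv (hq : 1 < q) (hy : 0 ≤ y) :
    HasDerivAt (fun t : ℝ => t * (1 + t ^ q) ^ (-(1 / q))) ((1 + y ^ q) ^ (-(1 / q) - 1)) y := by
  refine ((hasDerivAt_id y).mul (hasDerivAt_one_add_rpow_inv hq hy)).congr_deriv ?_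
  have e1 : (1 + y ^ q) ^ (-(1 / q)) = (1 + y ^ q) ^ (-(1 / q) - 1) * (1 + y ^ q) := by
    rw [← Real.rpow_add_one (one_add_rpow_pos q hy).ne']; ring_nf
  have e2 : y * y ^ (q - 1) = y ^ q := by
    rw [mul_comm, ← Real.rpow_add_one' hy (by linarith)]; ring_nf
  simp only [id, e1]
  linear_combination -(1 + y ^ q) ^ (-(1 / q) - 1) * e2

theorem one_add_rpow_inv_rpow (hq : q ≠ 0) (hy : 0 ≤ y) :
    ((1 + y ^ q) ^ (-(1 / q))) ^ q = (1 + y ^ q)⁻¹ := by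
  rw [← Real.rpow_mul (one_add_rpow_pos q hy).le, neg_mul, div_mul_cancel₀ _ hq,
    Real.rpow_neg_one]

theorem mul_one_add_rpow_inv_rpow (hq : q ≠ 0) (hy : 0 ≤ y) :
    (y * (1 + y ^ q) ^ (-(1 / q))) ^ q = 1 - (1 + y ^ q)⁻¹ := by
  have := one_add_rpow_pos q hy
  rw [Real.mul_rpow hy (by positivity), one_add_rpow_inv_rpow hq hy]
  field_simp
  ring

theorem one_add_rpow_injOn (hq : 0 < q) :
    InjOn (fun t : ℝ => (1 + t ^ q)⁻¹) (Ici 0) := by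
  intro a ha b hb hab
  exact Real.rpow_left_injOn hq.ne' ha hb (add_left_cancel (inv_injective hab))

theorem Ioo_subset_image_union (hq : 0 < q) :
    Ioo (0:ℝ) 1 ⊆ (fun t : ℝ => t * (1 + t ^ q) ^ (-(1 / q))) '' Ioc 0 1 ∪
      (fun t : ℝ => (1 + t ^ q) ^ (-(1 / q))) '' Ioc 0 1 := by
  intro t ht
  have h0 : 0 < t ^ q := Real.rpow_pos_of_pos ht.1 q
  have h1 : 0 < 1 - t ^ q := sub_pos.2 (Real.rpow_lt_one ht.1.le ht.2 hq)
  have hinv : ∀ {a : ℝ}, 0 ≤ a → (a ^ (1 / q)) ^ q = a := fun ha => by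
    rw [← Real.rpow_mul ha, one_div_mul_cancel hq.ne', Real.rpow_one]
  rcases le_total (t ^ q) (1 - t ^ q) with h | h
  · left
    have hd : 0 < t ^ q / (1 - t ^ q) := by positivity
    have hy : 0 < (t ^ q / (1 - t ^ q)) ^ (1 / q) := by positivity
    refine ⟨(t ^ q / (1 - t ^ q)) ^ (1 / q), ⟨hy,
      Real.rpow_le_one hd.le ((div_le_one h1).2 h) (by positivity)⟩, ?_⟩
    have := one_add_rpow_pos q hy.le
    refine Real.rpow_left_injOn hq.ne' (show (0:ℝ) ≤ _ by positivity) ht.1.le ?_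
    simp only
    rw [mul_one_add_rpow_inv_rpow hq.ne' hy.le, hinv hd.le]
    field_simp
    ring
  · right
    have hd : 0 < (1 - t ^ q) / t ^ q := by positivity
    have hy : 0 < ((1 - t ^ q) / t ^ q) ^ (1 / q) := by positivity
    refine ⟨((1 - t ^ q) / t ^ q) ^ (1 / q), ⟨hy,
      Real.rpow_le_one hd.le ((div_le_one h0).2 h) (by positivity)⟩, ?_⟩
    have := one_add_rpow_pos q hy.le
    refine Real.rpow_left_injOn hq.ne' (show (0:ℝ) ≤ _ by positivity) ht.1.le ?_
    simp only
    rw [one_add_rpow_inv_rpow hq.ne' hy.le, hinv hd.le]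
    field_simp
    ring

theorem lintegral_image_mul_one_add_rpow_inv (hq : 1 < q) :
    ∫⁻ t in (fun t : ℝ => t * (1 + t ^ q) ^ (-(1 / q))) '' Ioc 0 1,
      ENNReal.ofReal ((1 - t ^ q) ^ (-(1 / (q / (q - 1))))) =
    ∫⁻ t in Ioc (0:ℝ) 1, ENNReal.ofReal ((1 + t ^ q) ^ (-(1 / (q / 2)))) := by
  have hq0 : (0:ℝ) < q := by linarith
  rw [lintegral_image_eq_lintegral_abs_deriv_mul measurableSet_Ioc
    (fun t ht => (hasDerivAt_mul_one_add_rpow_inv hq ht.1.le).hasDerivWithinAt)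
    (fun a ha b hb hab => one_add_rpow_injOn hq0 ha.1.le hb.1.le (by
      have := congrArg (fun s : ℝ => s ^ q) hab
      simp only [mul_one_add_rpow_inv_rpow hq0.ne' ha.1.le,
        mul_one_add_rpow_inv_rpow hq0.ne' hb.1.le] at this
      simpa using this))]
  refine setLIntegral_congr_fun measurableSet_Ioc fun t ht => ?_
  have hp := one_add_rpow_pos q ht.1.le
  rw [abs_of_pos (by positivity), ← ENNReal.ofReal_mul (by positivity),
    mul_one_add_rpow_inv_rpow hq0.ne' ht.1.le, sub_sub_cancel, Real.inv_rpow hp.le,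
    ← Real.rpow_neg hp.le, ← Real.rpow_add hp]
  congr 2
  have : q - 1 ≠ 0 := by linarith
  field_simp
  ring

theorem lintegral_image_one_add_rpow_inv (hq : 1 < q) :
    ∫⁻ t in (fun t : ℝ => (1 + t ^ q) ^ (-(1 / q))) '' Ioc 0 1,
      ENNReal.ofReal ((1 - t ^ q) ^ (-(1 / (q / (q - 1))))) =
    ∫⁻ t in Ioc (0:ℝ) 1, ENNReal.ofReal ((1 + t ^ q) ^ (-(1 / (q / 2)))) := by
  have hq0 : (0:ℝ) < q := by linarith
  rw [lintegral_image_eq_lintegral_abs_deriv_mul measurableSet_Ioc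
    (fun t ht => (hasDerivAt_one_add_rpow_inv hq ht.1.le).hasDerivWithinAt)
    (fun a ha b hb hab => one_add_rpow_injOn hq0 ha.1.le hb.1.le (by
      have := congrArg (fun s : ℝ => s ^ q) hab
      simpa only [one_add_rpow_inv_rpow hq0.ne' ha.1.le,
        one_add_rpow_inv_rpow hq0.ne' hb.1.le] using this))]
  refine setLIntegral_congr_fun measurableSet_Ioc fun t ht => ?_
  have hp := one_add_rpow_pos q ht.1.le
  have ht0 := ht.1
  have htq : 0 < t ^ q := Real.rpow_pos_of_pos ht0 q
  have hsub : 1 - (1 + t ^ q)⁻¹ = t ^ q * (1 + t ^ q)⁻¹ := by field_simp; ring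
  rw [abs_neg, abs_of_pos (by positivity), ← ENNReal.ofReal_mul (by positivity),
    one_add_rpow_inv_rpow hq0.ne' ht.1.le, hsub, Real.mul_rpow htq.le (by positivity),
    Real.inv_rpow hp.le, ← Real.rpow_neg hp.le, ← Real.rpow_mul ht0.le, mul_mul_mul_comm,
    ← Real.rpow_add ht0, ← Real.rpow_add hp]
  have : q - 1 ≠ 0 := by linarith
  rw [show q - 1 + q * -(1 / (q / (q - 1))) = 0 by field_simp; ring, Real.rpow_zero, one_mul]
  congr 2
  field_simp
  ring

theorem lintegral_Ioc_one_add_rpow (p : ℝ) (hq : 0 ≤ q) :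
    ∫⁻ t in Ioc (0:ℝ) 1, ENNReal.ofReal ((1 + t ^ q) ^ (-(1 / p))) =
      ENNReal.ofReal (genG p q 1) := by
  rw [genG, intervalIntegral.integral_of_le zero_le_one, ofReal_integral_eq_lintegral_ofReal
    (intervalIntegrable_one_add_rpow_rpow hq _ le_rfl zero_le_one).1]
  filter_upwards [ae_restrict_mem measurableSet_Ioc] with t ht
  exact Real.rpow_nonneg (one_add_rpow_pos q ht.1.le).le _

theorem genPi_le (hq : 1 < q) :
    genPi (q / (q - 1)) q ≤ 4 * ENNReal.ofReal (genG (q / 2) q 1) := by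
  have h := ((lintegral_mono_set (Ioo_subset_image_union (by linarith))).trans
    (lintegral_union_le _ _ _)).trans_eq (congrArg₂ (· + ·)
      (lintegral_image_mul_one_add_rpow_inv hq) (lintegral_image_one_add_rpow_inv hq))
  rw [lintegral_Ioc_one_add_rpow _ (by linarith), ← two_mul] at h
  calc genPi (q / (q - 1)) q ≤ 2 * (2 * ENNReal.ofReal (genG (q / 2) q 1)) := by
        unfold genPi; gcongr
    _ = 4 * ENNReal.ofReal (genG (q / 2) q 1) := by rw [← mul_assoc]; norm_num

theorem exists_genG_eq (hq : 1 < q) {x : ℝ} (hx0 : 0 ≤ x)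
    (hx : ENNReal.ofReal x < genPi (q / (q - 1)) q / 4) :
    ∃ y, 0 ≤ y ∧ y < 1 ∧ genG (q / 2) q y = x := by
  have hlt : x < genG (q / 2) q 1 :=
    (ENNReal.ofReal_lt_ofReal_iff'.1
      (hx.trans_le (ENNReal.div_le_of_le_mul' (genPi_le hq)))).1
  obtain ⟨y, hy, rfl⟩ := intermediate_value_Ico zero_le_one
    (genG_continuousOn (q / 2) (by linarith : 0 ≤ q) zero_le_one)
    (show x ∈ Ico (genG (q / 2) q 0) (genG (q / 2) q 1) from ⟨by simpa [genG] using hx0, hlt⟩)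
  exact ⟨y, hy.1, hy.2, rfl⟩

end

/-- for `1 < q < ∞` and `x ∈ [0, π_{q*,q}/4)` (with `q* = q/(q-1)`),
`sinh_{2q/(q+2),q}(2^(2/q) x) = 2^(2/q) · sinh_{q/2,q} x / (1 - (sinh_{q/2,q} x)^q)^(2/q)`. -/
theorem multiple_angle_sinh (q : ℝ) (hq : 1 < q)
    (x : ℝ) (hx0 : 0 ≤ x) (hx : ENNReal.ofReal x < genPi (q / (q - 1)) q / 4) :
    gsinh (2 * q / (q + 2)) q ((2:ℝ) ^ (2 / q) * x) =
      (2:ℝ) ^ (2 / q) * gsinh (q / 2) q x / (1 - gsinh (q / 2) q x ^ q) ^ (2 / q) := by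
  obtain ⟨y, hy0, hy1, rfl⟩ := exists_genG_eq hq hx0 hx
  have hpos : 0 < 1 - y ^ q := sub_pos.2 (Real.rpow_lt_one hy0 hy1 (by linarith))
  rw [gsinh_genG _ (by linarith) hy0, ← genG_double_angle hq hy0 hy1,
    gsinh_genG _ (by linarith) (by positivity), Real.rpow_neg hpos.le, ← div_eq_mul_inv]
end
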